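/- arXiv:2306.09167 — 6 statements merged into one kernel-verified Lean document; each statement's English description precedes it below -/
import Mathlib

section
/- Let k be a commutative ring and A a non-unital, not necessarily associative k-algebra. Let δ : k → A be an additive map such that δ(r s) = r • δ(s) + s • δ(r) for all r, s ∈ k, and such that δ(r) · a = 0 = a · δ(r) for all r ∈ k and a ∈ A. Then the map σ : Unitization k A → Unitization k A given by σ(r, a) = (r, a + δ(r)) is a ring automorphism of Unitization k A which fixes the multiplicative identity 1 = (1,0) and fixes inr a = (0,a) for every a ∈ A. -/
/-- Let `k` be a commutative ring and `A` a non-unital, not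
necessarily associative `k`-algebra. If `δ : k → A` is additive, satisfies
`δ(r s) = r • δ s + s • δ r`, and its values annihilate `A` on both sides, then
`σ(r, a) = (r, a + δ r)` is a ring automorphism of `Unitization k A` which fixes
`1 = (1,0)` and fixes `inr a = (0,a)` for every `a ∈ A`. -/
theorem stmt_1 {k A : Type*} [CommRing k] [NonUnitalNonAssocRing A] [Module k A]
    (δ : k → A)
    (hδadd : ∀ r s : k, δ (r + s) = δ r + δ s)
    (hδder : ∀ r s : k, δ (r * s) = r • δ s + s • δ r)
    (hδann : ∀ (r : k) (a : A), δ r * a = 0 ∧ a * δ r = 0) :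
    let σ : Unitization k A → Unitization k A :=
      fun x => Unitization.inl x.fst + Unitization.inr (x.snd + δ x.fst)
    Function.Bijective σ ∧
      (∀ x y : Unitization k A, σ (x + y) = σ x + σ y) ∧
      (∀ x y : Unitization k A, σ (x * y) = σ x * σ y) ∧
      σ 1 = 1 ∧
      (∀ a : A, σ (Unitization.inr a) = Unitization.inr a) := by
  have h0 : δ 0 = 0 := by simpa using hδadd 0 0
  have h1 : δ 1 = 0 := by simpa using hδder 1 1
  have hl : ∀ (r : k) (a : A), δ r * a = 0 := fun r a => (hδann r a).1
  have hr : ∀ (r : k) (a : A), a * δ r = 0 := fun r a => (hδann r a).2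
  intro σ
  have hf : ∀ x, (σ x).fst = x.fst := fun x => by simp [σ]
  have hs : ∀ x, (σ x).snd = x.snd + δ x.fst := fun x => by simp [σ]
  refine ⟨⟨?_, ?_⟩, ?_, ?_, ?_, ?_⟩
  · intro x y h
    have e1 : x.fst = y.fst := by rw [← hf x, ← hf y, h]
    have e2 : x.snd + δ x.fst = y.snd + δ y.fst := by rw [← hs x, ← hs y, h]
    rw [e1] at e2
    exact Unitization.ext e1 (add_right_cancel e2)
  · intro y
    refine ⟨Unitization.inl y.fst + Unitization.inr (y.snd - δ y.fst), ?_⟩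
    apply Unitization.ext
    · rw [hf]; simp [-Unitization.inr_sub]
    · rw [hs]; simp [-Unitization.inr_sub]
  · intro x y
    apply Unitization.ext
    · simp [hf]
    · simp only [hs, Unitization.snd_add, Unitization.fst_add, hδadd]
      abel
  · intro x y
    apply Unitization.ext
    · simp [hf]
    · simp only [hs, hf, Unitization.snd_mul, Unitization.fst_mul, hδder, mul_add, add_mul,
        hl, hr, smul_add, add_zero]
      abel
  · apply Unitization.ext
    · simp [hf]
    · simp [hs, h1]
  · intro a
    apply Unitization.ext
    · simp [hf]
    · simp [hs, h0]
end

section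
/- Let L be a Lie ring that is 2-step nilpotent (⁅⁅x,y⁆,z⁆ = 0 for all x,y,z ∈ L) and 2-torsion-free (x + x = 0 implies x = 0), equipped with a map h : L → L satisfying h(x) + h(x) = x for all x ∈ L. Define x * y = x + y + h(⁅x,y⁆). Then (L, *) is a group: * is associative, 0 is a two-sided identity, and −x is a two-sided inverse of x for every x ∈ L. -/
/-- Let `L` be a 2-step nilpotent, 2-torsion-free Lie ring with a
halving map `h : L → L` (`h x + h x = x`). Then the Baker–Campbell–Hausdorff operation
`x * y = x + y + h ⁅x,y⁆` makes `L` a group: it is associative, `0` is a two-sided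
identity, and `-x` is a two-sided inverse of `x`. -/
theorem stmt_9 {L : Type*} [LieRing L]
    (hnil : ∀ x y z : L, ⁅⁅x, y⁆, z⁆ = 0)
    (htf : ∀ x : L, x + x = 0 → x = 0)
    (h : L → L) (hh : ∀ x : L, h x + h x = x) :
    let mul' : L → L → L := fun x y => x + y + h ⁅x, y⁆
    (∀ x y z : L, mul' (mul' x y) z = mul' x (mul' y z)) ∧
      (∀ x : L, mul' 0 x = x) ∧
      (∀ x : L, mul' x 0 = x) ∧
      (∀ x : L, mul' (-x) x = 0) ∧
      (∀ x : L, mul' x (-x) = 0) := by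
  have hu : ∀ a b : L, a + a = b + b → a = b := by
    intro a b hab
    refine sub_eq_zero.mp (htf _ ?_)
    have : a - b + (a - b) = (a + a) - (b + b) := by abel
    rw [this, hab, sub_self]
  have hadd : ∀ a b : L, h (a + b) = h a + h b := by
    intro a b
    apply hu
    have : h a + h b + (h a + h b) = (h a + h a) + (h b + h b) := by abel
    rw [this, hh, hh, hh]
  have h0 : h 0 = 0 := htf _ (hh 0)
  have hl : ∀ x y z : L, ⁅h ⁅x, y⁆, z⁆ = 0 := by
    intro x y z
    apply htf
    rw [← add_lie, hh, hnil]
  have hr : ∀ x y z : L, ⁅z, h ⁅x, y⁆⁆ = 0 := by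
    intro x y z
    rw [← lie_skew, hl, neg_zero]
  intro mul'
  refine ⟨?_, ?_, ?_, ?_, ?_⟩
  · intro x y z
    simp only [mul', add_lie, lie_add, hl, hr, hadd, h0]
    abel
  all_goals
    intro x
    simp [mul', h0]
end

section
/- Let R be a commutative unitary ring, m an ideal of R, and K a subring of R such that every element of R can be written uniquely as α + a with α ∈ K and a ∈ m (i.e., K + m = R and K ∩ m = {0} as additive groups). Let g : m → m be an additive bijection such that g(α a) = α g(a) for all α ∈ K and a ∈ m, g(a) − a annihilates m (that is, (g(a) − a) x = 0 for all x ∈ m) for every a ∈ m, and g(x) = x for every x in the ideal m². Then the map σ : R → R defined by σ(α + a) = α + g(a) is a ring automorphism of R. -/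
/-- Let `R` be a commutative unitary ring, `m` an ideal of `R` and
`K` a subring of `R` such that every element of `R` is uniquely `α + a` with `α ∈ K`,
`a ∈ m`. Let `g` be a bijection of `m` onto itself which is additive, `K`-linear
(`g(α a) = α g(a)` for `α ∈ K`), satisfies `(g(a) − a) x = 0` for all `a, x ∈ m`,
and is the identity on `m²`. Then the map `σ : R → R` determined by
`σ(α + a) = α + g(a)` is a ring automorphism of `R`. -/
theorem stmt_12 {R : Type*} [CommRing R] (K : Subring R) (m : Ideal R)
    (hdec : ∀ r : R, ∃! p : K × m, r = (p.1 : R) + (p.2 : R))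
    (g : R → R)
    (hg_bij : Set.BijOn g (m : Set R) (m : Set R))
    (hg_add : ∀ a ∈ m, ∀ b ∈ m, g (a + b) = g a + g b)
    (hg_lin : ∀ α ∈ K, ∀ a ∈ m, g (α * a) = α * g a)
    (hg_ann : ∀ a ∈ m, ∀ x ∈ m, (g a - a) * x = 0)
    (hg_sq : ∀ x ∈ m ^ 2, g x = x)
    (σ : R → R)
    (hσ : ∀ α ∈ K, ∀ a ∈ m, σ (α + a) = α + g a) :
    Function.Bijective σ ∧
      (∀ x y : R, σ (x + y) = σ x + σ y) ∧
      (∀ x y : R, σ (x * y) = σ x * σ y) ∧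
      σ 1 = 1 := by
  have dec : ∀ r : R, ∃ α ∈ K, ∃ a ∈ m, r = α + a := by
    intro r
    obtain ⟨p, hp, -⟩ := hdec r
    exact ⟨p.1, p.1.2, p.2, p.2.2, hp⟩
  have uniq : ∀ α ∈ K, ∀ a ∈ m, ∀ β ∈ K, ∀ b ∈ m, α + a = β + b → α = β ∧ a = b := by
    intro α hα a ha β hβ b hb h
    have h1 := (hdec (α + a)).unique (y₁ := (⟨α, hα⟩, ⟨a, ha⟩)) (y₂ := (⟨β, hβ⟩, ⟨b, hb⟩)) rfl h
    simpa using h1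
  have gm : ∀ a ∈ m, g a ∈ m := fun a ha => hg_bij.mapsTo ha
  refine ⟨⟨?_, ?_⟩, ?_, ?_, ?_⟩
  · intro x y hxy
    obtain ⟨α, hα, a, ha, rfl⟩ := dec x
    obtain ⟨β, hβ, b, hb, rfl⟩ := dec y
    rw [hσ α hα a ha, hσ β hβ b hb] at hxy
    obtain ⟨h1, h2⟩ := uniq α hα _ (gm a ha) β hβ _ (gm b hb) hxy
    rw [h1, hg_bij.injOn ha hb h2]
  · intro y
    obtain ⟨β, hβ, b, hb, rfl⟩ := dec y
    obtain ⟨a, ha, rfl⟩ := hg_bij.surjOn hb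
    exact ⟨β + a, hσ β hβ a ha⟩
  · intro x y
    obtain ⟨α, hα, a, ha, rfl⟩ := dec x
    obtain ⟨β, hβ, b, hb, rfl⟩ := dec y
    have e : α + a + (β + b) = (α + β) + (a + b) := by ring
    rw [e, hσ _ (K.add_mem hα hβ) _ (m.add_mem ha hb), hσ α hα a ha, hσ β hβ b hb,
      hg_add a ha b hb]
    ring
  · intro x y
    obtain ⟨α, hα, a, ha, rfl⟩ := dec x
    obtain ⟨β, hβ, b, hb, rfl⟩ := dec y
    have e : (α + a) * (β + b) = α * β + ((α * b + β * a) + a * b) := by ring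
    have h1 : α * b ∈ m := m.mul_mem_left _ hb
    have h2 : β * a ∈ m := m.mul_mem_left _ ha
    have h3 : a * b ∈ m := m.mul_mem_left _ hb
    have h4 : a * b ∈ m ^ 2 := by
      rw [pow_two]
      exact Ideal.mul_mem_mul ha hb
    rw [e, hσ _ (K.mul_mem hα hβ) _ (m.add_mem (m.add_mem h1 h2) h3), hσ α hα a ha,
      hσ β hβ b hb, hg_add _ (m.add_mem h1 h2) _ h3, hg_add _ h1 _ h2, hg_lin α hα b hb,
      hg_lin β hβ a ha, hg_sq _ h4]
    linear_combination -(hg_ann a ha _ (gm b hb)) - hg_ann b hb a ha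
  · have h0 : g 0 = 0 := hg_sq 0 (Ideal.zero_mem _)
    have := hσ 1 K.one_mem 0 m.zero_mem
    simpa [h0] using this
end

section
/- Let R be a commutative unitary ring, m an ideal of R, and K a subring of R such that every element of R can be written uniquely as α + a with α ∈ K and a ∈ m. Let f : m → m be an additive map with f(α a) = α f(a) for all α ∈ K, a ∈ m, whose image is contained in the annihilator ann(m) = {x ∈ R : x y = 0 for all y ∈ m}, and which vanishes on m² and on ann(m) ∩ m. Then the map σ : R → R defined by σ(α + a) = α + a + f(a) is a ring automorphism of R. -/
/-- Let `R` be a commutative unitary ring, `m` an ideal of `R` and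
`K` a subring of `R` such that every element of `R` is uniquely `α + a` with `α ∈ K`,
`a ∈ m`. Let `f : m → m` be additive and `K`-linear, with image contained in the
annihilator `ann(m) = {x : x y = 0 for all y ∈ m}`, vanishing on `m²` and on
`ann(m) ∩ m`. Then the map `σ : R → R` determined by `σ(α + a) = α + a + f(a)` is a
ring automorphism of `R`. -/
theorem stmt_13 {R : Type*} [CommRing R] (K : Subring R) (m : Ideal R)
    (hdec : ∀ r : R, ∃! p : K × m, r = (p.1 : R) + (p.2 : R))
    (f : R → R)
    (hf_mem : ∀ a ∈ m, f a ∈ m)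
    (hf_add : ∀ a ∈ m, ∀ b ∈ m, f (a + b) = f a + f b)
    (hf_lin : ∀ α ∈ K, ∀ a ∈ m, f (α * a) = α * f a)
    (hf_ann : ∀ a ∈ m, ∀ y ∈ m, f a * y = 0)
    (hf_sq : ∀ x ∈ m ^ 2, f x = 0)
    (hf_annm : ∀ x ∈ m, (∀ y ∈ m, x * y = 0) → f x = 0)
    (σ : R → R)
    (hσ : ∀ α ∈ K, ∀ a ∈ m, σ (α + a) = α + a + f a) :
    Function.Bijective σ ∧
      (∀ x y : R, σ (x + y) = σ x + σ y) ∧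
      (∀ x y : R, σ (x * y) = σ x * σ y) ∧
      σ 1 = 1 := by
  have dec : ∀ r : R, ∃ α ∈ K, ∃ a ∈ m, r = α + a := by
    intro r
    obtain ⟨p, hp, -⟩ := hdec r
    exact ⟨p.1, p.1.2, p.2, p.2.2, hp⟩
  have f0 : f 0 = 0 := hf_sq 0 (Ideal.zero_mem _)
  have ff : ∀ a ∈ m, f (f a) = 0 := fun a ha =>
    hf_annm _ (hf_mem a ha) (hf_ann a ha)
  have add : ∀ x y : R, σ (x + y) = σ x + σ y := by
    intro x y
    obtain ⟨α, hα, a, ha, rfl⟩ := dec x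
    obtain ⟨β, hβ, b, hb, rfl⟩ := dec y
    have e : α + a + (β + b) = (α + β) + (a + b) := by ring
    rw [e, hσ _ (K.add_mem hα hβ) _ (m.add_mem ha hb), hσ _ hα _ ha, hσ _ hβ _ hb,
      hf_add a ha b hb]
    ring
  have fneg : ∀ a ∈ m, f (-a) = - f a := by
    intro a ha
    have h := hf_add a ha (-a) (m.neg_mem ha)
    rw [add_neg_cancel, f0] at h
    linear_combination -h
  refine ⟨⟨?_, ?_⟩, add, ?_, ?_⟩
  · intro x y hxy
    obtain ⟨α, hα, a, ha, rfl⟩ := dec x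
    obtain ⟨β, hβ, b, hb, rfl⟩ := dec y
    rw [hσ _ hα _ ha, hσ _ hβ _ hb] at hxy
    have hu := (hdec (α + a + f a)).unique
      (y₁ := (⟨α, hα⟩, ⟨a + f a, m.add_mem ha (hf_mem a ha)⟩))
      (y₂ := (⟨β, hβ⟩, ⟨b + f b, m.add_mem hb (hf_mem b hb)⟩))
      (add_assoc _ _ _) (hxy.trans (add_assoc _ _ _))
    simp only [Prod.mk.injEq, Subtype.mk.injEq] at hu
    obtain ⟨h1, h2⟩ := hu
    have h3 := congrArg f h2
    rw [hf_add a ha _ (hf_mem a ha), hf_add b hb _ (hf_mem b hb), ff a ha, ff b hb] at h3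
    linear_combination h1 + h2 - h3
  · intro y
    obtain ⟨β, hβ, b, hb, rfl⟩ := dec y
    have hn := m.neg_mem (hf_mem b hb)
    refine ⟨β + (b + - f b), ?_⟩
    rw [hσ _ hβ _ (m.add_mem hb hn), hf_add b hb _ hn, fneg _ (hf_mem b hb), ff b hb]
    ring
  · intro x y
    obtain ⟨α, hα, a, ha, rfl⟩ := dec x
    obtain ⟨β, hβ, b, hb, rfl⟩ := dec y
    have hab : a * b ∈ m ^ 2 := by
      rw [pow_two]
      exact Ideal.mul_mem_mul ha hb
    have e : (α + a) * (β + b) = α * β + (α * b + (β * a + a * b)) := by ring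
    have m1 : α * b ∈ m := m.mul_mem_left _ hb
    have m2 : β * a ∈ m := m.mul_mem_left _ ha
    have m3 : a * b ∈ m := m.mul_mem_left _ hb
    rw [e, hσ _ (K.mul_mem hα hβ) _ (m.add_mem m1 (m.add_mem m2 m3)),
      hf_add _ m1 _ (m.add_mem m2 m3), hf_add _ m2 _ m3, hf_lin _ hα _ hb, hf_lin _ hβ _ ha,
      hf_sq _ hab, hσ _ hα _ ha, hσ _ hβ _ hb]
    linear_combination -hf_ann a ha b hb - hf_ann b hb a ha - hf_ann a ha _ (hf_mem b hb)
  · have h := hσ 1 K.one_mem 0 m.zero_mem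
    simpa [f0] using h
end

section
/- Let R be a commutative unitary ring and m a nilpotent ideal of R (m^n = 0 for some n ≥ 1). Let A = {x ∈ R : x y = 0 for all y ∈ m} be the annihilator of m, and assume A ⊆ m. If m = m² + A, then m² = 0 and consequently m = A. -/
/-- Let `R` be a commutative unitary ring and `m` a nilpotent ideal
(`m ^ n = 0` for some `n ≥ 1`). Let `A = {x : x y = 0 for all y ∈ m}` be the
annihilator of `m` and assume `A ⊆ m`. If `m = m² + A`, then `m² = 0` and
consequently `m = A`. -/
theorem stmt_14 {R : Type*} [CommRing R] (m A : Ideal R)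
    (hA : ∀ x : R, x ∈ A ↔ ∀ y ∈ m, x * y = 0)
    (hAm : A ≤ m)
    (hnil : ∃ n : ℕ, 1 ≤ n ∧ m ^ n = ⊥)
    (hsum : m = m ^ 2 + A) :
    m ^ 2 = ⊥ ∧ m = A := by
  have hAm0 : A * m = ⊥ := by
    rw [eq_bot_iff, Ideal.mul_le]
    intro x hx y hy
    exact (Submodule.mem_bot R).2 ((hA x).1 hx y hy)
  have h3 : m ^ 2 = m ^ 2 * m := by
    calc m ^ 2 = m * m := pow_two m
      _ = (m ^ 2 + A) * m := by rw [← hsum]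
      _ = m ^ 2 * m + A * m := add_mul _ _ _
      _ = m ^ 2 * m := by rw [hAm0]; exact add_zero _
  have hk : ∀ k : ℕ, m ^ 2 = m ^ 2 * m ^ k := by
    intro k
    induction k with
    | zero => rw [pow_zero, mul_one]
    | succ k ih => rw [pow_succ m k, ← mul_assoc, ← ih, ← h3]
  obtain ⟨n, _, hn⟩ := hnil
  have h2 : m ^ 2 = ⊥ := by
    rw [hk n, hn]
    exact mul_zero _
  refine ⟨h2, ?_⟩
  rw [h2] at hsum
  exact hsum.trans (zero_add A)
end

section
/- Let R and M be non-associative rings with biadditive actions R × M → M and M × R → M, and let Λ = Λ(R,M) be the associated triangular ring. Write ann_R(M) = {r ∈ R : r·m = 0 = m·r for all m ∈ M}, ann_M(R) = {m ∈ M : r·m = 0 = m·r for all r ∈ R}, ann_R(ann(M)) = {r ∈ R : r·x = 0 = x·r for all x ∈ ann(M)}, where ann(R) and ann(M) are the two-sided ring annihilators. Assume ann(R) = ann_R(M) = ann_R(ann(M)). Then the annihilator of the triangular ring Λ equals ann(R) × (ann(M) ∩ ann_M(R)); that is, an element (r,m) satisfies (r,m)·u = 0 = u·(r,m) for all u ∈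 Λ if and only if r ∈ ann(R), m ∈ ann(M) and m ∈ ann_M(R). -/
/-- Let `R`, `M` be non-associative rings with biadditive actions
`R × M → M` and `M × R → M`, and `Λ = Λ(R,M)` the triangular ring. Assume
`ann(R) = ann_R(M) = ann_R(ann(M))`. Then the annihilator of `Λ` equals
`ann(R) × (ann(M) ∩ ann_M(R))`: an element `(r,m)` annihilates `Λ` on both sides
iff `r ∈ ann(R)`, `m ∈ ann(M)` and `m ∈ ann_M(R)`. -/
theorem stmt_15 {R M : Type*} [AddCommGroup R] [AddCommGroup M]
    (mulR : R → R → R) (mulM : M → M → M)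
    (smul : R → M → M) (smul' : M → R → M)
    (hmulR₁ : ∀ a b c : R, mulR (a + b) c = mulR a c + mulR b c)
    (hmulR₂ : ∀ a b c : R, mulR a (b + c) = mulR a b + mulR a c)
    (hmulM₁ : ∀ a b c : M, mulM (a + b) c = mulM a c + mulM b c)
    (hmulM₂ : ∀ a b c : M, mulM a (b + c) = mulM a b + mulM a c)
    (hsmul₁ : ∀ (a b : R) (m : M), smul (a + b) m = smul a m + smul b m)
    (hsmul₂ : ∀ (a : R) (m m' : M), smul a (m + m') = smul a m + smul a m')
    (hsmul'₁ : ∀ (m m' : M) (a : R), smul' (m + m') a = smul' m a + smul' m' a)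
    (hsmul'₂ : ∀ (m : M) (a b : R), smul' m (a + b) = smul' m a + smul' m b)
    -- `ann(R) = ann_R(M)`:
    (hannRM : ∀ r : R,
      (∀ r' : R, mulR r r' = 0 ∧ mulR r' r = 0) ↔
        (∀ m : M, smul r m = 0 ∧ smul' m r = 0))
    -- `ann(R) = ann_R(ann(M))`:
    (hannRannM : ∀ r : R,
      (∀ r' : R, mulR r r' = 0 ∧ mulR r' r = 0) ↔
        (∀ m : M, (∀ m' : M, mulM m m' = 0 ∧ mulM m' m = 0) →
          smul r m = 0 ∧ smul' m r = 0)) :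
    let lmul : R × M → R × M → R × M := fun u v =>
      (mulR u.1 v.1, smul u.1 v.2 + smul' u.2 v.1 + mulM u.2 v.2)
    ∀ (r : R) (m : M),
      (∀ u : R × M, lmul (r, m) u = 0 ∧ lmul u (r, m) = 0) ↔
        ((∀ r' : R, mulR r r' = 0 ∧ mulR r' r = 0) ∧
          (∀ m' : M, mulM m m' = 0 ∧ mulM m' m = 0) ∧
          (∀ r' : R, smul r' m = 0 ∧ smul' m r' = 0)) := by
  intro lmul r m
  have z1 : ∀ x, smul 0 x = 0 := fun x => by simpa using hsmul₁ 0 0 x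
  have z2 : ∀ a, smul a 0 = 0 := fun a => by simpa using hsmul₂ a 0 0
  have z3 : ∀ a, smul' 0 a = 0 := fun a => by simpa using hsmul'₁ 0 0 a
  have z4 : ∀ x, smul' x 0 = 0 := fun x => by simpa using hsmul'₂ x 0 0
  have z5 : ∀ x, mulM 0 x = 0 := fun x => by simpa using hmulM₁ 0 0 x
  have z6 : ∀ x, mulM x 0 = 0 := fun x => by simpa using hmulM₂ x 0 0
  constructor
  · intro h
    have hr : ∀ r' : R, mulR r r' = 0 ∧ mulR r' r = 0 := fun r' =>
      ⟨congrArg Prod.fst (h (r', 0)).1, congrArg Prod.fst (h (r', 0)).2⟩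
    have hm := (hannRM r).1 hr
    refine ⟨hr, fun m' => ?_, fun r' => ?_⟩
    · have h1 : smul r m' + smul' m 0 + mulM m m' = 0 := congrArg Prod.snd (h (0, m')).1
      have h2 : smul 0 m + smul' m' r + mulM m' m = 0 := congrArg Prod.snd (h (0, m')).2
      rw [(hm m').1, z4, zero_add, zero_add] at h1
      rw [(hm m').2, z1, zero_add, zero_add] at h2
      exact ⟨h1, h2⟩
    · have h1 : smul r 0 + smul' m r' + mulM m 0 = 0 := congrArg Prod.snd (h (r', 0)).1
      have h2 : smul r' m + smul' 0 r + mulM 0 m = 0 := congrArg Prod.snd (h (r', 0)).2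
      rw [z2, z6, zero_add, add_zero] at h1
      rw [z3, z5, add_zero, add_zero] at h2
      exact ⟨h2, h1⟩
  · rintro ⟨hr, hM, hR⟩ ⟨a, x⟩
    have hm := (hannRM r).1 hr
    constructor
    · apply Prod.ext
      · exact (hr a).1
      · change smul r x + smul' m a + mulM m x = 0
        rw [(hm x).1, (hR a).2, (hM x).1, add_zero, add_zero]
    · apply Prod.ext
      · exact (hr a).2
      · change smul a m + smul' x r + mulM x m = 0
        rw [(hm x).2, (hR a).1, (hM x).2, add_zero, add_zero]
end
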